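/- Assume additionally that h is a regular value of H : U → ℝ. Then for every smooth function α : V → (0,∞), the set Γ is a periodic orbit of the perturbed system dv/dt = X(v) + α(v)(C(v)−c)[∇H(v) × (∇H(v) × ∇C(v))], v ∈ V, and Γ is orbitally phase asymptotically stable with respect to perturbations in the invariant set H⁻¹({h}) ∩ V. -/

import Mathlib

open scoped RealInnerProductSpace

noncomputable section

abbrev E3 := EuclideanSpace ℝ (Fin 3)

/-- The cross product on `EuclideanSpace ℝ (Fin 3)`. -/
noncomputable def cross3 (a b : E3) : E3 :=
  (WithLp.equiv 2 (Fin 3 → ℝ)).symm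
    (crossProduct (WithLp.equiv 2 (Fin 3 → ℝ) a) (WithLp.equiv 2 (Fin 3 → ℝ) b))

/-- `x` is a forward-in-time solution of `v' = Y v` in `V` with `x 0 = x₀`. -/
def IsForwardSolution {E : Type*} [NormedAddCommGroup E] [NormedSpace ℝ E]
    (Y : E → E) (V : Set E) (x₀ : E) (x : ℝ → E) : Prop :=
  x 0 = x₀ ∧ ∀ t : ℝ, 0 ≤ t → x t ∈ V ∧ HasDerivWithinAt x (Y (x t)) (Set.Ici 0) t

/-- Orbital stability of the set `Γ` for the system `v' = Y v` on `V`,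
with respect to perturbations (initial conditions) in `S`. -/
def OrbitallyStable {E : Type*} [NormedAddCommGroup E] [NormedSpace ℝ E]
    (Y : E → E) (V S Γ : Set E) : Prop :=
  ∀ ε > 0, ∃ δ' > 0, ∀ x₀ ∈ S, Metric.infDist x₀ Γ < δ' →
    ∀ x : ℝ → E, IsForwardSolution Y V x₀ x → ∀ t ≥ (0:ℝ), Metric.infDist (x t) Γ < ε

/-- Orbital phase asymptotic stability of the periodic orbit `Γ` (traced by `γ`)
for the system `v' = Y v` on `V`, with respect to perturbations in `S`. -/
def OrbitallyPhaseAsymptoticallyStable {E : Type*} [NormedAddCommGroup E] [NormedSpace ℝ E]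
    (Y : E → E) (V S : Set E) (γ : ℝ → E) (Γ : Set E) : Prop :=
  ∃ δ > 0,
    (∀ x₀ ∈ S, Metric.infDist x₀ Γ < δ → ∃ x : ℝ → E, IsForwardSolution Y V x₀ x) ∧
    (∀ ε > 0, ∃ δ' > 0, δ' ≤ δ ∧ ∀ x₀ ∈ S, Metric.infDist x₀ Γ < δ' →
      ∀ x : ℝ → E, IsForwardSolution Y V x₀ x → ∀ t ≥ (0:ℝ), Metric.infDist (x t) Γ < ε) ∧
    (∀ x₀ ∈ S, Metric.infDist x₀ Γ < δ → ∀ x : ℝ → E, IsForwardSolution Y V x₀ x →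
      Filter.Tendsto (fun t => Metric.infDist (x t) Γ) Filter.atTop (nhds 0) ∧
      ∃ θ₀ : ℝ, Filter.Tendsto (fun t => dist (x t) (γ (t + θ₀))) Filter.atTop (nhds 0))

open Set Filter Topology Metric
open scoped NNReal Manifold ContDiff

lemma E3.inner_eq (a b : E3) : ⟪a, b⟫ = a 0 * b 0 + a 1 * b 1 + a 2 * b 2 := by
  simp [PiLp.inner_apply, Fin.sum_univ_three, mul_comm]

lemma cross3_eq (a b : E3) :
    cross3 a b = !₂[a 1 * b 2 - a 2 * b 1, a 2 * b 0 - a 0 * b 2, a 0 * b 1 - a 1 * b 0] := rfl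

lemma inner_cross3_left (a b : E3) : ⟪a, cross3 a b⟫ = 0 := by
  simp [E3.inner_eq, cross3_eq]
  ring

lemma inner_cross3_right (a b : E3) : ⟪b, cross3 a b⟫ = 0 := by
  simp [E3.inner_eq, cross3_eq]
  ring

lemma inner_cross3_cross3 (a b : E3) :
    ⟪b, cross3 a (cross3 a b)⟫ = -‖cross3 a b‖ ^ 2 := by
  rw [← real_inner_self_eq_norm_sq, E3.inner_eq, E3.inner_eq]
  simp [cross3_eq]
  ring

lemma cross3_ne_zero {a b : E3} (hab : LinearIndependent ℝ ![a, b]) : cross3 a b ≠ 0 := by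
  intro h0
  have hli : LinearIndependent ℝ ![a.ofLp, b.ofLp] := by
    rw [LinearIndependent.pair_iff] at hab ⊢
    exact fun s t hst => hab s t (WithLp.ofLp_injective 2 hst)
  exact crossProduct_ne_zero_iff_linearIndependent.2 hli
    ((WithLp.equiv 2 (Fin 3 → ℝ)).symm.injective h0)

lemma eq_zero_of_inner_cross3 {a b v : E3} (hab : cross3 a b ≠ 0) (ha : ⟪a, v⟫ = 0)
    (hb : ⟪b, v⟫ = 0) (hc : ⟪cross3 a b, v⟫ = 0) : v = 0 := by
  have key : ⟪cross3 a b, cross3 a b⟫ • v = ⟪cross3 a b, v⟫ • cross3 a b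
      + (⟪a, v⟫ * ⟪b, b⟫ - ⟪b, v⟫ * ⟪a, b⟫) • a + (⟪b, v⟫ * ⟪a, a⟫ - ⟪a, v⟫ * ⟪a, b⟫) • b := by
    simp only [E3.inner_eq]
    ext i
    fin_cases i <;> simp [cross3_eq] <;> ring
  simpa [ha, hb, hc, hab] using key

lemma ContDiffOn.cross3 {E : Type*} [NormedAddCommGroup E] [NormedSpace ℝ E] {n : WithTop ℕ∞}
    {f g : E → E3} {s : Set E} (hf : ContDiffOn ℝ n f s) (hg : ContDiffOn ℝ n g s) :
    ContDiffOn ℝ n (fun x => cross3 (f x) (g x)) s := by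
  rw [contDiffOn_euclidean] at *
  intro i
  fin_cases i <;> simp [_root_.cross3, crossProduct]
  · exact ((hf 1).mul (hg 2)).sub ((hf 2).mul (hg 1))
  · exact ((hf 2).mul (hg 0)).sub ((hf 0).mul (hg 2))
  · exact ((hf 0).mul (hg 1)).sub ((hf 1).mul (hg 0))

lemma ContDiffOn.gradient {E : Type*} [NormedAddCommGroup E] [InnerProductSpace ℝ E]
    [CompleteSpace E] {f : E → ℝ} {s : Set E} {m n : WithTop ℕ∞} (hf : ContDiffOn ℝ n f s)
    (hs : IsOpen s) (hmn : m + 1 ≤ n) : ContDiffOn ℝ m (gradient f) s :=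
  (InnerProductSpace.toDual ℝ E).symm.toContinuousLinearEquiv.toContinuousLinearMap.contDiff
    |>.comp_contDiffOn (hf.fderiv_of_isOpen hs hmn)

/-- A `C¹` compactly supported vector field is complete. -/
lemma exists_integralCurve_of_hasCompactSupport {E : Type*} [NormedAddCommGroup E]
    [NormedSpace ℝ E] [CompleteSpace E] {Z : E → E} (hZ : ContDiff ℝ 1 Z)
    (hc : HasCompactSupport Z) (x₀ : E) :
    ∃ x : ℝ → E, x 0 = x₀ ∧ ∀ t, HasDerivAt x (Z (x t)) t := by
  obtain ⟨K, hK⟩ := hZ.lipschitzWith_of_hasCompactSupport hc one_ne_zero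
  obtain ⟨L, hL⟩ := hZ.continuous.bounded_above_of_compact_support hc
  have hL0 : 0 ≤ L := (norm_nonneg _).trans (hL x₀)
  have hM : CMDiff 1 (fun x ↦ (⟨x, Z x⟩ : TangentBundle 𝓘(ℝ, E) E)) :=
    contMDiff_vectorSpace_iff_contDiff.2 hZ
  obtain ⟨x, hx0, hx⟩ := exists_isMIntegralCurve_of_isMIntegralCurveOn hM one_pos (fun y => by
    have hPL : IsPicardLindelof (fun _ ↦ Z) (tmin := -1) (tmax := 1)
        ⟨0, by norm_num, by norm_num⟩ y ⟨L, hL0⟩ 0 ⟨L, hL0⟩ K :=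
      .of_time_independent (fun x _ => hL x) hK.lipschitzOnWith (by simp)
    obtain ⟨f, hf0, hf⟩ := hPL.exists_eq_forall_mem_Icc_hasDerivWithinAt₀
    exact ⟨f, hf0, fun t ht => ((hf t (Ioo_subset_Icc_self ht)).mono
      Ioo_subset_Icc_self).hasFDerivWithinAt.hasMFDerivWithinAt⟩) x₀
  refine ⟨x, hx0, fun t => ?_⟩
  have h : HasFDerivAt (F := E) x ((1 : ℝ →L[ℝ] ℝ).smulRight (Z (x t))) t := (hx t).hasFDerivAt
  simpa using h.hasDerivAt

lemma HasStrictFDerivAt.exists_norm_sub_le {E F : Type*} [NormedAddCommGroup E] [NormedSpace ℝ E]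
    [FiniteDimensional ℝ E] [NormedAddCommGroup F] [NormedSpace ℝ F] {f : E → F} {f' : E →L[ℝ] F}
    {p : E} (hf : HasStrictFDerivAt f f' p) (hinj : ∀ v, f' v = 0 → v = 0) :
    ∃ K, 0 < K ∧ ∀ᶠ q : E × E in 𝓝 (p, p), ‖q.1 - q.2‖ ≤ K * ‖f q.1 - f q.2‖ := by
  obtain ⟨K, -, hK⟩ := (f' : E →ₗ[ℝ] F).exists_antilipschitzWith
    (LinearMap.ker_eq_bot'.2 hinj)
  exact (hf.isTheta_sub
    (hK.isUniformInducing f'.uniformContinuous).isInducing).isBigO_symm.exists_pos.imp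
      fun _ h => ⟨h.1, h.2.bound⟩

lemma exists_asymptotic_phase {E : Type*} [NormedAddCommGroup E] [NormedSpace ℝ E]
    [CompleteSpace E] {Z : E → E} {K : ℝ≥0} (hZ : LipschitzWith K Z) {γ x : ℝ → E} {T A l : ℝ}
    (hT : 0 < T) (hγ : ∀ t, HasDerivAt γ (Z (γ t)) t) (hper : Function.Periodic γ T)
    (hx : ∀ t, 0 ≤ t → HasDerivWithinAt x (Z (x t)) (Ici 0) t) (hl : 0 < l)
    (hdist : ∀ t, 0 ≤ t → infDist (x t) (range γ) ≤ A * Real.exp (-l * t)) :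
    ∃ θ : ℝ, Tendsto (fun t => dist (x t) (γ (t + θ))) atTop (𝓝 0) := by
  have hγc : Continuous γ := continuous_iff_continuousAt.2 fun t => (hγ t).continuousAt
  have hΓ : IsCompact (range γ) := by
    rw [← hper.image_Icc hT 0]
    exact isCompact_Icc.image hγc
  have gronwall : ∀ a, 0 ≤ a → ∀ σ, ∀ t ∈ Icc a (a + T),
      dist (x t) (γ (t - a + σ)) ≤ dist (x a) (γ σ) * Real.exp (K * T) := by
    intro a ha σ t ht
    have hd : ∀ s, HasDerivAt (fun s => γ (s - a + σ)) (Z (γ (s - a + σ))) s := fun s => by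
      have h := (hγ (s - a + σ)).scomp s (((hasDerivAt_id s).sub_const a).add_const σ)
      rwa [one_smul] at h
    refine (dist_le_of_trajectories_ODE (v := fun _ => Z) (fun _ => hZ)
      (fun s hs => ((hx s (ha.trans hs.1)).continuousWithinAt).mono fun u hu => ha.trans hu.1)
      (fun s hs => (hx s (ha.trans hs.1)).mono (Ici_subset_Ici.2 (ha.trans hs.1)))
      (fun s _ => (hd s).continuousAt.continuousWithinAt)
      (fun s _ => (hd s).hasDerivWithinAt) (δ := dist (x a) (γ σ)) (by simp) t ht).trans ?_
    gcongr
    linarith [ht.2]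
  have hn : ∀ n : ℕ, 0 ≤ n * T := fun n => by positivity
  have hstep : ∀ n : ℕ, dist (x (n * T)) (x ((n + 1 : ℕ) * T))
      ≤ A * (1 + Real.exp (K * T)) * Real.exp (-l * T) ^ n := by
    intro n
    obtain ⟨_, ⟨σ, rfl⟩, hσ⟩ := hΓ.exists_infDist_eq_dist (range_nonempty γ) (x (n * T))
    have h1 := gronwall _ (hn n) σ (n * T + T) ⟨by linarith, le_rfl⟩
    rw [show n * T + T - n * T + σ = σ + T by ring, hper] at h1
    have h2 := hdist _ (hn n)
    rw [hσ, show -l * (n * T) = n * (-l * T) by ring, Real.exp_nat_mul] at h2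
    rw [show ((n + 1 : ℕ) : ℝ) * T = n * T + T by push_cast; ring]
    calc _ ≤ dist (x (n * T)) (γ σ) + dist (x (n * T + T)) (γ σ) := dist_triangle_right _ _ _
      _ ≤ dist (x (n * T)) (γ σ) * (1 + Real.exp (K * T)) := by linarith
      _ ≤ A * Real.exp (-l * T) ^ n * (1 + Real.exp (K * T)) := by gcongr
      _ = _ := by ring
  have hr : Real.exp (-l * T) < 1 := by rw [Real.exp_lt_one_iff]; nlinarith
  obtain ⟨p, hp⟩ := cauchySeq_tendsto_of_complete (cauchySeq_of_le_geometric _ _ hr hstep)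
  have hnT : Tendsto (fun n : ℕ => (n : ℝ) * T) atTop atTop :=
    tendsto_natCast_atTop_atTop.atTop_mul_const hT
  have hexp : Tendsto (fun t => A * Real.exp (-l * t)) atTop (𝓝 0) := by
    simpa using (Real.tendsto_exp_atBot.comp
      (tendsto_id.const_mul_atTop_of_neg (neg_neg_of_pos hl))).const_mul A
  have hp0 : infDist p (range γ) = 0 :=
    tendsto_nhds_unique (((continuous_infDist_pt _).tendsto p).comp hp)
      (squeeze_zero (fun _ => infDist_nonneg) (fun n => hdist _ (hn n)) (hexp.comp hnT))
  obtain ⟨θ, rfl⟩ := (hΓ.isClosed.mem_iff_infDist_zero (range_nonempty γ)).2 hp0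
  refine ⟨θ, ?_⟩
  have hfloor : Tendsto (fun t : ℝ => ⌊t / T⌋₊) atTop atTop :=
    tendsto_nat_floor_atTop.comp (tendsto_id.atTop_div_const hT)
  have hlim := ((tendsto_iff_dist_tendsto_zero.1 hp).comp hfloor).mul_const (Real.exp (K * T))
  rw [zero_mul] at hlim
  refine squeeze_zero' (.of_forall fun _ => dist_nonneg) ?_ hlim
  filter_upwards [eventually_ge_atTop 0] with t ht
  have h1 := gronwall _ (hn ⌊t / T⌋₊) θ t ⟨(le_div_iff₀ hT).1 (Nat.floor_le (by positivity)), by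
    have := (div_lt_iff₀ hT).1 (Nat.lt_floor_add_one (t / T))
    linarith⟩
  rwa [show t - ⌊t / T⌋₊ * T + θ = t + θ - ⌊t / T⌋₊ * T by ring, hper.sub_nat_mul_eq] at h1

lemma IsCompact.exists_eventually_nhdsSet_le_mul {E : Type*} [TopologicalSpace E] {S : Set E}
    (hS : IsCompact S) {P : E → Prop} {f g : E → ℝ} (hg : ∀ x, 0 ≤ g x)
    (hloc : ∀ p ∈ S, ∃ K, 0 < K ∧ ∀ᶠ x in 𝓝 p, P x → f x ≤ K * g x) :
    ∃ K, 0 < K ∧ ∀ᶠ x in 𝓝ˢ S, P x → f x ≤ K * g x := by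
  refine hS.induction_on (p := fun s => ∃ K, 0 < K ∧ ∀ᶠ x in 𝓝ˢ s, P x → f x ≤ K * g x)
    ⟨1, one_pos, by simp⟩ (fun s t hst ⟨K, hK, h⟩ => ⟨K, hK, h.filter_mono (nhdsSet_mono hst)⟩)
    ?_ ?_
  · rintro s t ⟨K, hK, hs⟩ ⟨L, -, ht⟩
    refine ⟨max K L, lt_max_of_lt_left hK, ?_⟩
    rw [nhdsSet_union, eventually_sup]
    exact ⟨hs.mono fun x hx hP => (hx hP).trans
        (mul_le_mul_of_nonneg_right (le_max_left _ _) (hg x)),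
      ht.mono fun x hx hP => (hx hP).trans (mul_le_mul_of_nonneg_right (le_max_right _ _) (hg x))⟩
  · intro p hp
    obtain ⟨K, hK, h⟩ := hloc p hp
    obtain ⟨O, hO, hOo, hpO⟩ := eventually_nhds_iff.1 h
    exact ⟨O, mem_nhdsWithin_of_mem_nhds (hOo.mem_nhds hpO), K, hK,
      mem_of_superset hOo.mem_nhdsSet_self hO⟩

lemma infDist_le_mul_exp_of_lyapunov {E : Type*} [NormedAddCommGroup E] [NormedSpace ℝ E]
    {Y : E → E} {H D g : E → ℝ} {S : Set E} {r K l h : ℝ} (hK : 0 ≤ K) (hl : 0 ≤ l)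
    (hHd : ∀ u, infDist u S ≤ r → DifferentiableAt ℝ H u)
    (hDd : ∀ u, infDist u S ≤ r → DifferentiableAt ℝ D u)
    (hHY : ∀ u, infDist u S ≤ r → fderiv ℝ H u (Y u) = 0)
    (hDY : ∀ u, infDist u S ≤ r → fderiv ℝ D u (Y u) = -(g u * D u))
    (hg : ∀ u, infDist u S ≤ r → l ≤ g u)
    (hdist : ∀ u, infDist u S ≤ r → H u = h → infDist u S ≤ K * |D u|)
    {x : ℝ → E} (hxc : ContinuousOn x (Ici 0))
    (hx : ∀ t, 0 ≤ t → infDist (x t) S ≤ r → HasDerivWithinAt x (Y (x t)) (Ici 0) t)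
    (hx0 : infDist (x 0) S ≤ r) (hH0 : H (x 0) = h) (hD0 : K * |D (x 0)| < r) :
    ∀ t, 0 ≤ t → infDist (x t) S < r ∧
      infDist (x t) S ≤ K * |D (x 0)| * Real.exp (-l * t) := by
  have decay : ∀ b, 0 ≤ b → (∀ t ∈ Icc 0 b, infDist (x t) S ≤ r) →
      infDist (x b) S ≤ K * |D (x 0)| * Real.exp (-l * b) := by
    intro b hb hr
    have hsub : Icc 0 b ⊆ Ici (0 : ℝ) := fun _ ht => ht.1
    have hHx : ∀ t ∈ Icc 0 b, HasDerivWithinAt (H ∘ x) 0 (Ici 0) t := fun t ht => by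
      have h := (hHd _ (hr t ht)).hasFDerivAt.comp_hasDerivWithinAt t (hx t ht.1 (hr t ht))
      rwa [hHY _ (hr t ht)] at h
    have hDx : ∀ t ∈ Icc 0 b,
        HasDerivWithinAt (D ∘ x) (-(g (x t) * D (x t))) (Ici 0) t := fun t ht => by
      have h := (hDd _ (hr t ht)).hasFDerivAt.comp_hasDerivWithinAt t (hx t ht.1 (hr t ht))
      rwa [hDY _ (hr t ht)] at h
    have hHb : H (x b) = h := by
      rw [← hH0]
      exact constant_of_has_deriv_right_zero
        (fun t ht => (hHx t ht).continuousWithinAt.mono hsub)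
        (fun t ht => (hHx t (Ico_subset_Icc_self ht)).mono (Ici_subset_Ici.2 ht.1)) b
        (right_mem_Icc.2 hb)
    have hanti : AntitoneOn (fun t => (D (x t) * Real.exp (l * t)) ^ 2) (Icc 0 b) := by
      have hd : ∀ t ∈ Icc 0 b, HasDerivWithinAt (fun t => (D (x t) * Real.exp (l * t)) ^ 2)
          (2 * (l - g (x t)) * (D (x t) * Real.exp (l * t)) ^ 2) (Ici 0) t := fun t ht => by
        have h1 : HasDerivWithinAt (fun t => Real.exp (l * t)) (Real.exp (l * t) * l) (Ici 0) t :=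
          by simpa using ((hasDerivAt_id t).const_mul l).exp.hasDerivWithinAt
        refine (((hDx t ht).mul h1).pow 2).congr_deriv ?_
        simp
        ring
      have hd' : ∀ t ∈ interior (Icc 0 b), HasDerivAt (fun t => (D (x t) * Real.exp (l * t)) ^ 2)
          (2 * (l - g (x t)) * (D (x t) * Real.exp (l * t)) ^ 2) t := fun t ht => by
        rw [interior_Icc] at ht
        exact (hd t (Ioo_subset_Icc_self ht)).hasDerivAt (Ici_mem_nhds ht.1)
      refine antitoneOn_of_deriv_nonpos (convex_Icc 0 b)
        (fun t ht => (hd t ht).continuousWithinAt.mono hsub)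
        (fun t ht => (hd' t ht).differentiableAt.differentiableWithinAt) fun t ht => ?_
      rw [(hd' t ht).deriv]
      have := hg _ (hr t (interior_subset ht))
      exact mul_nonpos_of_nonpos_of_nonneg (by linarith) (sq_nonneg _)
    have hDb := sq_le_sq.1 (hanti (left_mem_Icc.2 hb) (right_mem_Icc.2 hb) hb)
    rw [abs_mul, abs_mul, Real.abs_exp, Real.abs_exp, mul_zero, Real.exp_zero, mul_one] at hDb
    have hDb' : |D (x b)| ≤ |D (x 0)| * Real.exp (-l * b) := by
      calc |D (x b)| = |D (x b)| * Real.exp (l * b) * Real.exp (-l * b) := by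
            rw [mul_assoc, ← Real.exp_add]; simp
        _ ≤ _ := by gcongr
    calc infDist (x b) S ≤ K * |D (x b)| := hdist _ (hr b (right_mem_Icc.2 hb)) hHb
      _ ≤ K * (|D (x 0)| * Real.exp (-l * b)) := by gcongr
      _ = _ := by ring
  have hφ : ContinuousOn (fun t => infDist (x t) S) (Ici 0) :=
    (continuous_infDist_pt S).comp_continuousOn hxc
  have hlt : ∀ t, 0 ≤ t → infDist (x t) S < r := by
    by_contra! hne
    set B := Ici (0 : ℝ) ∩ (fun t => infDist (x t) S) ⁻¹' Ici r with hB
    have hBc : IsClosed B := hφ.preimage_isClosed_of_isClosed isClosed_Ici isClosed_Ici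
    have hBb : BddBelow B := ⟨0, fun t ht => ht.1⟩
    have hmem : sInf B ∈ B := hBc.csInf_mem hne hBb
    have hbelow : ∀ t, 0 ≤ t → t < sInf B → infDist (x t) S < r := fun t ht htB => by
      by_contra! hcon
      exact (csInf_le hBb ⟨ht, hcon⟩).not_gt htB
    have hpos : 0 < sInf B := by
      refine lt_of_le_of_ne hmem.1 fun h0 => ?_
      have h1 : r ≤ infDist (x (sInf B)) S := hmem.2
      rw [← h0] at h1
      linarith [hdist _ hx0 hH0]
    have hlim : Tendsto (fun t => infDist (x t) S) (𝓝[Ioo 0 (sInf B)] (sInf B))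
        (𝓝 (infDist (x (sInf B)) S)) :=
      (hφ _ hmem.1).mono fun t ht => ht.1.le
    have : (𝓝[Ioo 0 (sInf B)] (sInf B)).NeBot := by
      rw [← mem_closure_iff_nhdsWithin_neBot, closure_Ioo hpos.ne]
      exact right_mem_Icc.2 hpos.le
    have hle : infDist (x (sInf B)) S ≤ K * |D (x 0)| := by
      refine le_of_tendsto hlim ?_
      filter_upwards [self_mem_nhdsWithin] with t ht
      refine (decay t ht.1.le fun s hs => (hbelow s hs.1 (hs.2.trans_lt ht.2)).le).trans ?_
      refine mul_le_of_le_one_right (by positivity) (Real.exp_le_one_iff.2 ?_)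
      nlinarith [ht.1]
    exact absurd hmem.2 (by simpa using hle.trans_lt hD0)
  exact fun t ht => ⟨hlt t ht, decay t ht fun s hs => (hlt s hs.1).le⟩

lemma eventually_infDist_le_of_cross3 {H C : E3 → ℝ} {γ γ' : ℝ → E3} {t₀ k h c : ℝ}
    (hH : ContDiffAt ℝ 1 H (γ t₀)) (hC : ContDiffAt ℝ 1 C (γ t₀))
    (hn : cross3 (gradient H (γ t₀)) (gradient C (γ t₀)) ≠ 0)
    (hγ : ∀ t, HasDerivAt γ (γ' t) t) (hγ' : ContinuousAt γ' t₀) (hk : k ≠ 0)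
    (hγk : γ' t₀ = k • cross3 (gradient H (γ t₀)) (gradient C (γ t₀)))
    (hHγ : ∀ t, H (γ t) = h) (hCγ : ∀ t, C (γ t) = c) :
    ∃ K, 0 < K ∧ ∀ᶠ x in 𝓝 (γ t₀), H x = h → infDist x (range γ) ≤ K * |C x - c| := by
  set w := cross3 (gradient H (γ t₀)) (gradient C (γ t₀)) with hw
  have hF := ((hH.hasStrictFDerivAt one_ne_zero).prodMk
    ((hC.hasStrictFDerivAt one_ne_zero).prodMk ((innerSL ℝ w).hasStrictFDerivAt (x := γ t₀))))
  obtain ⟨K, hK, hev⟩ := hF.exists_norm_sub_le fun v hv => by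
    simp only [ContinuousLinearMap.prod_apply, Prod.mk_eq_zero, innerSL_apply_apply] at hv
    refine eq_zero_of_inner_cross3 hn ?_ ?_ hv.2.2
    · simpa [gradient] using hv.1
    · simpa [gradient] using hv.2.1
  rw [nhds_prod_eq, eventually_prod_iff] at hev
  obtain ⟨P, hP, Q, hQ, hPQ⟩ := hev
  have hg : HasStrictDerivAt (fun t => ⟪w, γ t⟫) ⟪w, γ' t₀⟫ t₀ :=
    (innerSL ℝ w).hasStrictFDerivAt.comp_hasStrictDerivAt t₀
      (hasStrictDerivAt_of_hasDerivAt_of_continuousAt (.of_forall hγ) hγ')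
  have hg0 : ⟪w, γ' t₀⟫ ≠ 0 := by
    rw [hγk, inner_smul_right]
    exact mul_ne_zero hk (inner_self_ne_zero.2 hn)
  have himage : (fun t => ⟪w, γ t⟫) '' {t | Q (γ t)} ∈ 𝓝 ⟪w, γ t₀⟫ := by
    rw [← hg.map_nhds_eq hg0]
    exact image_mem_map ((hγ t₀).continuousAt.eventually hQ)
  have hcov : ∀ᶠ x in 𝓝 (γ t₀), ⟪w, x⟫ ∈ (fun t => ⟪w, γ t⟫) '' {t | Q (γ t)} :=
    (innerSL ℝ w).continuous.continuousAt.eventually himage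
  refine ⟨K, hK, ?_⟩
  filter_upwards [hP, hcov] with x hx ⟨t, ht, hxt⟩ hHx
  have h1 := hPQ hx ht
  simp only [innerSL_apply_apply, hHx, hHγ, hCγ, ← hxt, Prod.mk_sub_mk, sub_self] at h1
  rw [← dist_eq_norm] at h1
  simpa using (infDist_le_dist_of_mem (mem_range_self t)).trans h1

/-- A `C¹` vector field on an open set can be replaced by a compactly supported `C¹` one without
changing it on a given compact subset. -/
lemma ContDiffOn.exists_hasCompactSupport_eqOn {E : Type*} [NormedAddCommGroup E]
    [NormedSpace ℝ E] [FiniteDimensional ℝ E] {Y : E → E} {V N : Set E} (hV : IsOpen V)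
    (hY : ContDiffOn ℝ 1 Y V) (hN : IsCompact N) (hNV : N ⊆ V) :
    ∃ Z : E → E, ContDiff ℝ 1 Z ∧ HasCompactSupport Z ∧ EqOn Z Y N := by
  obtain ⟨M, hM, hNM, hMV⟩ := exists_compact_between hN hV hNV
  obtain ⟨f, hf1, hf0, -⟩ :=
    exists_contMDiffMap_one_nhds_of_subset_interior 𝓘(ℝ, E) (n := 1) hN.isClosed hNM
  have hsupp : tsupport (fun x => f x • Y x) ⊆ M :=
    closure_minimal (fun x hx => by
      by_contra hxM
      exact hx (by simp [hf0 x hxM])) hM.isClosed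
  refine ⟨fun x => f x • Y x, contDiff_iff_contDiffAt.2 fun x => ?_,
    hM.of_isClosed_subset (isClosed_tsupport _) hsupp, fun x hx => ?_⟩
  · by_cases hx : x ∈ tsupport fun x => f x • Y x
    · exact f.contMDiff.contDiff.contDiffAt.smul (hY.contDiffAt (hV.mem_nhds (hMV (hsupp hx))))
    · exact contDiffAt_const.congr_of_eventuallyEq (notMem_tsupport_iff_eventuallyEq.1 hx)
  · simp [hf1.self_of_nhdsSet x hx]

lemma ne_zero_of_periodic_nonconstant {E : Type*} [NormedAddCommGroup E]
    [NormedSpace ℝ E] [FiniteDimensional ℝ E] {Y : E → E} {V : Set E} (hV : IsOpen V)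
    (hY : ContDiffOn ℝ 1 Y V) {γ : ℝ → E} (hγ : ∀ t, HasDerivAt γ (Y (γ t)) t)
    (hc : IsCompact (range γ)) (hγV : range γ ⊆ V) (hne : ∃ s t, γ s ≠ γ t) (t₀ : ℝ) :
    Y (γ t₀) ≠ 0 := by
  intro h0
  obtain ⟨Z, hZ, hZc, hZY⟩ := hY.exists_hasCompactSupport_eqOn hV hc hγV
  obtain ⟨K, hK⟩ := hZ.lipschitzWith_of_hasCompactSupport hZc one_ne_zero
  have hconst : γ = fun _ => γ t₀ :=
    ODE_solution_unique_univ (v := fun _ => Z) (s := fun _ => univ) (t₀ := t₀)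
      (fun _ => hK.lipschitzOnWith)
      (fun t => ⟨by rw [hZY (mem_range_self t)]; exact hγ t, mem_univ _⟩)
      (fun t => ⟨by rw [hZY (mem_range_self t₀), h0]; exact hasDerivAt_const t _, mem_univ _⟩) rfl
  obtain ⟨s, t, hst⟩ := hne
  exact hst (by rw [hconst])

lemma inner_gradient_eq_fderiv {E : Type*} [NormedAddCommGroup E] [InnerProductSpace ℝ E]
    [CompleteSpace E] (f : E → ℝ) (u v : E) : ⟪gradient f u, v⟫ = fderiv ℝ f u v := by
  simp [gradient]

/-- If moreover `h` is a regular value of `H`, then for every smooth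
`α : V → (0,∞)`, `Γ` is a periodic orbit of the perturbed system
`v' = X(v) + α(v)(C(v)−c)[∇H(v) × (∇H(v) × ∇C(v))]` and is orbitally phase
asymptotically stable with respect to perturbations in `H⁻¹({h}) ∩ V`. -/
theorem stmt_12
    (U : Set E3) (hU : IsOpen U) (ν H C : E3 → ℝ)
    (hν : ContDiffOn ℝ (⊤ : ℕ∞) ν U) (hH : ContDiffOn ℝ (⊤ : ℕ∞) H U)
    (hC : ContDiffOn ℝ (⊤ : ℕ∞) C U)
    (X : E3 → E3) (hX : ∀ u, X u = ν u • cross3 (gradient H u) (gradient C u))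
    (V : Set E3) (hV : IsOpen V) (hVU : V ⊆ U)
    (hind : ∀ u ∈ V, LinearIndependent ℝ ![gradient H u, gradient C u])
    (γ : ℝ → E3) (T : ℝ) (hT : 0 < T)
    (hγV : ∀ t, γ t ∈ V)
    (hsol : ∀ t, HasDerivAt γ (X (γ t)) t)
    (hper : ∀ t, γ (t + T) = γ t)
    (hnonconst : ∃ s t, γ s ≠ γ t)
    (Γ : Set E3) (hΓ : Γ = γ '' Set.Icc 0 T)
    (h c : ℝ) (hHγ : ∀ t, H (γ t) = h) (hCγ : ∀ t, C (γ t) = c)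
    (hreg : ∀ u ∈ U, H u = h → C u = c →
      LinearIndependent ℝ ![gradient H u, gradient C u])
    (hregH : ∀ u ∈ U, H u = h → gradient H u ≠ 0)
    (α : E3 → ℝ) (hα : ContDiffOn ℝ (⊤ : ℕ∞) α V) (hαpos : ∀ u ∈ V, 0 < α u)
    (Y : E3 → E3)
    (hY : ∀ u, Y u = X u
      + (α u * (C u - c)) • cross3 (gradient H u) (cross3 (gradient H u) (gradient C u))) :
    (∀ t, HasDerivAt γ (Y (γ t)) t) ∧
      OrbitallyPhaseAsymptoticallyStable Y V (H ⁻¹' {h} ∩ V) γ Γ := by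
  have hYsol : ∀ t, HasDerivAt γ (Y (γ t)) t := fun t => by
    simpa [hY, hCγ] using hsol t
  refine ⟨hYsol, ?_⟩
  have hγc : Continuous γ := continuous_iff_continuousAt.2 fun t => (hsol t).continuousAt
  obtain rfl : Γ = range γ := by
    simpa [hΓ] using Function.Periodic.image_Icc hper hT 0
  have hΓc : IsCompact (range γ) := hΓ ▸ isCompact_Icc.image hγc
  have hΓne : (range γ).Nonempty := range_nonempty γ
  have hΓV : range γ ⊆ V := range_subset_iff.2 hγV
  -- regularity of the vector fields
  have htop : (1 : WithTop ℕ∞) ≤ ((⊤ : ℕ∞) : WithTop ℕ∞) := by exact_mod_cast le_top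
  have htop2 : (1 : WithTop ℕ∞) + 1 ≤ ((⊤ : ℕ∞) : WithTop ℕ∞) :=
    WithTop.coe_le_coe.2 (le_top : (1 + 1 : ℕ∞) ≤ ⊤)
  have hH1 : ContDiffOn ℝ 1 H V := (hH.mono hVU).of_le htop
  have hC1 : ContDiffOn ℝ 1 C V := (hC.mono hVU).of_le htop
  have hgH : ContDiffOn ℝ 1 (gradient H) V := (hH.mono hVU).gradient hV htop2
  have hgC : ContDiffOn ℝ 1 (gradient C) V := (hC.mono hVU).gradient hV htop2
  have hHC : ContDiffOn ℝ 1 (fun u => cross3 (gradient H u) (gradient C u)) V := hgH.cross3 hgC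
  have hX1 : ContDiffOn ℝ 1 X V :=
    (((hν.mono hVU).of_le htop).smul hHC).congr fun u _ => hX u
  have hY1 : ContDiffOn ℝ 1 Y V :=
    (hX1.add (((hα.of_le htop).mul (hC1.sub contDiffOn_const)).smul (hgH.cross3 hHC))).congr
      fun u _ => hY u
  have hHV : ∀ u ∈ V, ContDiffAt ℝ 1 H u := fun u hu => hH1.contDiffAt (hV.mem_nhds hu)
  have hCV : ∀ u ∈ V, ContDiffAt ℝ 1 C u := fun u hu => hC1.contDiffAt (hV.mem_nhds hu)
  -- the level set of `C` controls the distance to the orbit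
  have hloc : ∀ p ∈ range γ, ∃ K, 0 < K ∧
      ∀ᶠ x in 𝓝 p, H x = h → infDist x (range γ) ≤ K * |C x - c| := by
    rintro _ ⟨t, rfl⟩
    have hX0 := ne_zero_of_periodic_nonconstant hV hX1 hsol hΓc hΓV hnonconst t
    refine eventually_infDist_le_of_cross3 (γ' := fun t => X (γ t)) (hHV _ (hγV t))
      (hCV _ (hγV t)) (cross3_ne_zero (hind _ (hγV t))) hsol
      ((hX1.continuousOn.continuousAt (hV.mem_nhds (hγV t))).comp hγc.continuousAt) ?_
      (hX (γ t)) hHγ hCγ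
    intro h0
    simp [hX, h0] at hX0
  obtain ⟨K, hK, hev⟩ := hΓc.exists_eventually_nhdsSet_le_mul (fun x => abs_nonneg (C x - c)) hloc
  obtain ⟨r, hr, hrsub⟩ := (hasBasis_nhdsSet_cthickening hΓc).mem_iff.1
    (hev.and (hV.mem_nhdsSet.2 hΓV))
  set N := cthickening r (range γ) with hN
  have hNc : IsCompact N := hΓc.cthickening
  have hmemN : ∀ u, infDist u (range γ) ≤ r → u ∈ N := fun u hu =>

    mem_cthickening_iff.2 (ENNReal.le_ofReal_iff_toReal_le (infEDist_ne_top hΓne) hr.le |>.2 hu)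
  have hNV : N ⊆ V := fun u hu => (hrsub hu).2
  obtain ⟨Z, hZ, hZc, hZY⟩ := hY1.exists_hasCompactSupport_eqOn hV hNc hNV
  obtain ⟨L, hL⟩ := hZ.lipschitzWith_of_hasCompactSupport hZc one_ne_zero
  -- the decay rate of `C - c`
  set g : E3 → ℝ := fun u => α u * ‖cross3 (gradient H u) (gradient C u)‖ ^ 2 with hg
  have hgpos : ∀ u ∈ V, 0 < g u := fun u hu =>
    mul_pos (hαpos u hu) (pow_pos (norm_pos_iff.2 (cross3_ne_zero (hind u hu))) 2)
  obtain ⟨l, hl, hgl⟩ : ∃ l, 0 < l ∧ ∀ u ∈ N, l ≤ g u := by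
    obtain ⟨u₀, hu₀, hmin⟩ := hNc.exists_isMinOn
      (hΓne.mono (self_subset_cthickening _))
      ((hα.continuousOn.mul (hHC.continuousOn.norm.pow 2)).mono hNV)
    exact ⟨g u₀, hgpos _ (hNV hu₀), fun u hu => hmin hu⟩
  have hlyap := fun (x : ℝ → E3) => infDist_le_mul_exp_of_lyapunov (Y := Y) (H := H)
    (D := fun u => C u - c) (g := g) (S := range γ) (r := r) (h := h) (x := x) hK.le hl.le
    (fun u hu => (hHV u (hNV (hmemN u hu))).differentiableAt one_ne_zero)
    (fun u hu => ((hCV u (hNV (hmemN u hu))).differentiableAt one_ne_zero).sub_const c)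
    (fun u hu => by
      rw [← inner_gradient_eq_fderiv, hY, hX, inner_add_right, inner_smul_right,
        inner_smul_right, inner_cross3_left, inner_cross3_left]
      simp)
    (fun u hu => by
      rw [fderiv_sub_const, ← inner_gradient_eq_fderiv, hY, hX, inner_add_right,
        inner_smul_right, inner_smul_right, inner_cross3_right, inner_cross3_cross3]
      ring)
    (fun u hu => hgl u (hmemN u hu)) (fun u hu => (hrsub (hmemN u hu)).1)
  have hsmall : ∀ ε > 0, ∃ δ > 0, ∀ u, infDist u (range γ) < δ →
      infDist u (range γ) ≤ r ∧ K * |C u - c| < ε := by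
    intro ε hε
    have hnear : ∀ᶠ u in 𝓝ˢ (range γ), K * |C u - c| < ε := by
      rw [eventually_nhdsSet_iff_forall]
      rintro _ ⟨t, rfl⟩
      have hcont : ContinuousAt (fun u => K * |C u - c|) (γ t) :=
        (((hCV _ (hγV t)).continuousAt.sub continuousAt_const).abs).const_mul K
      exact hcont.eventually_lt_const (by simpa [hCγ] using hε)
    obtain ⟨δ, hδ, hδsub⟩ := (hasBasis_nhdsSet_thickening hΓc).mem_iff.1 hnear
    refine ⟨min δ r, lt_min hδ hr, fun u hu => ⟨(hu.trans_le (min_le_right _ _)).le, hδsub ?_⟩⟩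
    exact mem_thickening_iff.2 ((infDist_lt_iff hΓne).1 (hu.trans_le (min_le_left _ _)))
  obtain ⟨δ, hδ, hδr⟩ := hsmall r hr
  have hsolution : ∀ x₀ ∈ H ⁻¹' {h} ∩ V, infDist x₀ (range γ) < δ → ∀ x : ℝ → E3,
      IsForwardSolution Y V x₀ x → ∀ t, 0 ≤ t → infDist (x t) (range γ) < r ∧
        infDist (x t) (range γ) ≤ K * |C x₀ - c| * Real.exp (-l * t) := by
    rintro x₀ ⟨hx₀, -⟩ hd x ⟨rfl, hx⟩
    exact hlyap x (fun t ht => (hx t ht).2.continuousWithinAt) (fun t ht _ => (hx t ht).2)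
      (hδr _ hd).1 hx₀ (hδr _ hd).2
  refine ⟨δ, hδ, fun x₀ hx₀ hd => ?_, fun ε hε => ?_, fun x₀ hx₀ hd x hx => ?_⟩
  · obtain ⟨x, rfl, hx⟩ := exists_integralCurve_of_hasCompactSupport hZ hZc x₀
    have hbound := hlyap x (fun t _ => (hx t).continuousAt.continuousWithinAt)
      (fun t _ ht => hZY (hmemN _ ht) ▸ (hx t).hasDerivWithinAt) (hδr _ hd).1 hx₀.1 (hδr _ hd).2
    refine ⟨x, rfl, fun t ht => ?_⟩
    have hxN := hmemN _ (hbound t ht).1.le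
    exact ⟨hNV hxN, hZY hxN ▸ (hx t).hasDerivWithinAt⟩
  · obtain ⟨δ₁, hδ₁, hδ₁ε⟩ := hsmall ε hε
    refine ⟨min δ δ₁, lt_min hδ hδ₁, min_le_left _ _, fun x₀ hx₀ hd x hx t ht => ?_⟩
    have h1 := (hsolution x₀ hx₀ (hd.trans_le (min_le_left _ _)) x hx t ht).2
    have h2 := (hδ₁ε x₀ (hd.trans_le (min_le_right _ _))).2
    refine (h1.trans (mul_le_of_le_one_right (by positivity) ?_)).trans_lt h2
    rw [Real.exp_le_one_iff]
    nlinarith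
  · have hb := hsolution x₀ hx₀ hd x hx
    have hexp : Tendsto (fun t => K * |C x₀ - c| * Real.exp (-l * t)) atTop (𝓝 0) := by
      simpa using (Real.tendsto_exp_atBot.comp
        (tendsto_id.const_mul_atTop_of_neg (neg_neg_of_pos hl))).const_mul (K * |C x₀ - c|)
    refine ⟨squeeze_zero' (.of_forall fun _ => infDist_nonneg)
      ((eventually_ge_atTop 0).mono fun t ht => (hb t ht).2) hexp, ?_⟩
    refine exists_asymptotic_phase hL hT (fun t => ?_) hper (fun t ht => ?_) hl
      fun t ht => (hb t ht).2
    · rw [hZY (self_subset_cthickening _ (mem_range_self t))]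
      exact hYsol t
    · rw [hZY (hmemN _ (hb t ht).1.le)]
      exact (hx.2 t ht).2
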